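/- Let (A, m) be a reduced Cohen-Macaulay local ring of Krull dimension two with canonical module K. Then the assignment M ↦ M^† := Hom_A(Hom_A(M, K), K) defines a left adjoint to the inclusion of the category of maximal Cohen-Macaulay modules into the category of finitely generated A-modules: for every finitely generated M and every maximal Cohen-Macaulay N, the canonical map Hom_A(M^†, N) → Hom_A(M, N) induced by the natural morphism M → M^† is an isomorphism. -/

import Mathlib

open CategoryTheory IsLocalRing

/-- The `i`-th Ext group `Ext^i_A(k, M)` as an object of `ModuleCat A`. -/
noncomputable def extGroup (A : Type) [CommRing A] (k M : Type)
    [AddCommGroup k] [Module A k] [AddCommGroup M] [Module A M] (i : ℕ) :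
    ModuleCat A :=
  ((Ext A (ModuleCat A) i).obj (Opposite.op (ModuleCat.of A k))).obj (ModuleCat.of A M)

/-- Depth via vanishing of `Ext^i(k, M)`. -/
noncomputable def eDepth (A : Type) [CommRing A] (k M : Type)
    [AddCommGroup k] [Module A k] [AddCommGroup M] [Module A M] : ℕ∞ :=
  sInf ((fun n : ℕ => (n : ℕ∞)) '' {i : ℕ | Nontrivial (extGroup A k M i)})

/-- A maximal Cohen-Macaulay module over a local ring: finitely generated of
depth equal to the Krull dimension of the ring. -/
def IsMCMMod (A : Type) [CommRing A] [IsLocalRing A]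
    (M : Type) [AddCommGroup M] [Module A M] : Prop :=
  Module.Finite A M ∧
    (eDepth A (ResidueField A) M : WithBot ℕ∞) = ringKrullDim A

/-- A canonical module of a `d`-dimensional Cohen-Macaulay local ring:
a finitely generated module `K` with `dim_k Ext^i_A(k, K) = δ_{i,d}`. -/
def IsCanonicalModule (A : Type) [CommRing A] [IsLocalRing A] (d : ℕ)
    (K : Type) [AddCommGroup K] [Module A K] : Prop :=
  Module.Finite A K ∧
    (∀ i : ℕ, i ≠ d → Subsingleton (extGroup A (ResidueField A) K i)) ∧
    Nonempty ((extGroup A (ResidueField A) K d) ≃ₗ[A] ResidueField A)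

open scoped Pointwise nonZeroDivisors

namespace CategoryTheory.ProjectiveResolution

variable {A : Type} [CommRing A] {X : ModuleCat.{0} A} (P : ProjectiveResolution X)
  (Y : ModuleCat.{0} A) (n : ℕ)

/-- The class in `Extⁿ(X, Y)` of a degree `n` cocycle of `Hom(P, Y)`. -/
noncomputable def cocycleToExt :
    LinearMap.ker (Linear.leftComp A Y (P.complex.d (n + 1) n)) →ₗ[A] Abelian.Ext X Y n where
  toFun f := P.extMk f.1 (n + 1) rfl f.2
  map_add' f g := (P.add_extMk f.1 g.1 (n + 1) rfl f.2 g.2).symm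
  map_smul' r f := by
    refine ((Abelian.Ext.smul_eq_comp_mk₀ (P.extMk f.1 (n + 1) rfl f.2) r).trans
      ((P.extMk_comp_mk₀ f.1 (n + 1) rfl f.2 (r • 𝟙 Y)).trans ?_)).symm
    congr 1

lemma cocycleToExt_surjective : Function.Surjective (P.cocycleToExt Y n) := fun α ↦ by
  obtain ⟨f, hf, rfl⟩ := P.extMk_surjective α (n + 1) rfl
  exact ⟨⟨f, hf⟩, rfl⟩

lemma cocycleToExt_eq_zero (f) (g : P.complex.X (n - 1) ⟶ Y)
    (h : P.complex.d n (n - 1) ≫ g = f.1) : P.cocycleToExt Y n f = 0 := by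
  cases n with
  | zero =>
    have : f = 0 := Subtype.ext (by rw [← h]; simp)
    rw [this, map_zero]
  | succ n => exact (P.extMk_eq_zero_iff f.1 (n + 1 + 1) rfl f.2 n rfl).2 ⟨g, h⟩

lemma exists_eq_of_cocycleToExt_eq_zero (hn : n ≠ 0) (f) (h : P.cocycleToExt Y n f = 0) :
    ∃ g : P.complex.X (n - 1) ⟶ Y, P.complex.d n (n - 1) ≫ g = f.1 :=
  (P.extMk_eq_zero_iff f.1 (n + 1) rfl f.2 (n - 1) (by lia)).1 h

lemma exists_linearMap_homology_ext :
    ∃ φ : (P.complex.linearYonedaObj A Y).homology n →ₗ[A] Abelian.Ext X Y n,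
      Function.Surjective φ ∧ (n ≠ 0 → Function.Injective φ) := by
  let C := P.complex.linearYonedaObj A Y
  let S : ShortComplex (ModuleCat A) := C.sc' (n - 1) n (n + 1)
  have e1 : C.homology n ≅ S.moduleCatLeftHomologyData.H :=
    ShortComplex.homologyMapIso (C.isoSc' (n - 1) n (n + 1) (by cases n <;> simp) (by simp)) ≪≫
      S.moduleCatHomologyIso
  let ψ : (LinearMap.ker S.g.hom ⧸ LinearMap.range S.moduleCatToCycles) →ₗ[A] Abelian.Ext X Y n :=
    Submodule.liftQ _ (P.cocycleToExt Y n) (by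
      rintro _ ⟨g, rfl⟩
      exact P.cocycleToExt_eq_zero Y n _ g rfl)
  refine ⟨ψ.comp e1.toLinearEquiv.toLinearMap, ?_, fun hn ↦ ?_⟩
  · refine Function.Surjective.comp (g := ψ) (fun α ↦ ?_) e1.toLinearEquiv.surjective
    obtain ⟨f, rfl⟩ := P.cocycleToExt_surjective Y n α
    exact ⟨Submodule.Quotient.mk f, rfl⟩
  · refine Function.Injective.comp (g := ψ) ?_ e1.toLinearEquiv.injective
    rw [injective_iff_map_eq_zero]
    intro a ha
    obtain ⟨f, rfl⟩ := Submodule.Quotient.mk_surjective _ a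
    obtain ⟨g, hg⟩ := P.exists_eq_of_cocycleToExt_eq_zero Y n hn f ha
    exact (Submodule.Quotient.mk_eq_zero _).2 ⟨g, Subtype.ext hg⟩

end CategoryTheory.ProjectiveResolution

lemma mem_annihilator_quotSMulTop {A : Type} [CommRing A] (r : A)
    (M : Type) [AddCommGroup M] [Module A M] : r ∈ Module.annihilator A (QuotSMulTop r M) := by
  refine Module.mem_annihilator.2 fun z ↦ ?_
  obtain ⟨z, rfl⟩ := Submodule.mkQ_surjective _ z
  rw [← map_smul]
  exact (Submodule.Quotient.mk_eq_zero _).2 (Submodule.smul_mem_pointwise_smul _ _ _ trivial)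

namespace ModuleCat
variable {A : Type} [CommRing A]

section Covariant
variable {M : Type} [AddCommGroup M] [Module A M] {r : A} (hr : IsSMulRegular M r)
  (L : Type) [AddCommGroup L] [Module A L]

/-- The connecting homomorphism of `0 → M → M → M / rM → 0`. -/
noncomputable def extQuotSMulTop (n : ℕ) :
    Abelian.Ext (ModuleCat.of A L) (.of A (QuotSMulTop r M)) n →ₗ[A]
      Abelian.Ext (ModuleCat.of A L) (.of A M) (n + 1) :=
  (IsSMulRegular.smulShortComplex_shortExact (M := .of A M) hr).extClass.postcompOfLinear A _ rfl

variable {L}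

lemma extQuotSMulTop_surjective (h : r ∈ Module.annihilator A L) (n : ℕ) :
    Function.Surjective (extQuotSMulTop hr L n) := fun x ↦
  Abelian.Ext.covariant_sequence_exact₁ (.of A L)
    (IsSMulRegular.smulShortComplex_shortExact (M := .of A M) hr) x
    (congr($(Abelian.Ext.postcomp_smul_id_eq_zero_of_mem_annihilator
      (M := .of A M) (N := .of A L) h (n + 1)) x)) rfl

lemma exists_of_extQuotSMulTop_eq_zero {n : ℕ}
    (x : Abelian.Ext (ModuleCat.of A L) (.of A (QuotSMulTop r M)) n)
    (hx : extQuotSMulTop hr L n x = 0) :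
    ∃ y : Abelian.Ext (ModuleCat.of A L) (.of A M) n,
      y.comp (.mk₀ (ModuleCat.ofHom (r • (⊤ : Submodule A M)).mkQ)) (add_zero n) = x :=
  Abelian.Ext.covariant_sequence_exact₃ (.of A L)
    (IsSMulRegular.smulShortComplex_shortExact (M := .of A M) hr) x (n₁ := n + 1) rfl hx

lemma extQuotSMulTop_injective (n : ℕ)
    [Subsingleton (Abelian.Ext (ModuleCat.of A L) (.of A M) n)] :
    Function.Injective (extQuotSMulTop hr L n) := by
  rw [injective_iff_map_eq_zero]
  intro x hx
  obtain ⟨y, rfl⟩ := exists_of_extQuotSMulTop_eq_zero hr x hx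
  rw [Subsingleton.elim y 0, Abelian.Ext.zero_comp]

lemma extQuotSMulTop_precomp {L' : Type} [AddCommGroup L'] [Module A L'] (f : L' →ₗ[A] L) (n : ℕ)
    (x : Abelian.Ext (ModuleCat.of A L) (.of A (QuotSMulTop r M)) n) :
    extQuotSMulTop hr L' n ((Abelian.Ext.mk₀ (ModuleCat.ofHom f)).comp x (zero_add n)) =
      (Abelian.Ext.mk₀ (ModuleCat.ofHom f)).comp (extQuotSMulTop hr L n x) (zero_add (n + 1)) :=
  Abelian.Ext.comp_assoc _ _ _ _ (rfl : n + 1 = n + 1) (by lia)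

end Covariant

lemma subsingleton_ext_quotSMulTop {M L : Type} [AddCommGroup M] [Module A M] [AddCommGroup L]
    [Module A L] {r : A} (hr : IsSMulRegular M r) (n : ℕ)
    [Subsingleton (Abelian.Ext (ModuleCat.of A L) (.of A M) n)]
    [Subsingleton (Abelian.Ext (ModuleCat.of A L) (.of A M) (n + 1))] :
    Subsingleton (Abelian.Ext (ModuleCat.of A L) (.of A (QuotSMulTop r M)) n) :=
  (extQuotSMulTop_injective hr n).subsingleton

lemma subsingleton_ext_zero_iff {M N : Type} [AddCommGroup M] [Module A M] [AddCommGroup N]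
    [Module A N] :
    Subsingleton (Abelian.Ext (ModuleCat.of A M) (.of A N) 0) ↔ Subsingleton (M →ₗ[A] N) :=
  (Abelian.Ext.linearEquiv₀ (R := A) ≪≫ₗ ModuleCat.homLinearEquiv (S := A)).toEquiv.subsingleton_congr

lemma exists_comp_mkQ_eq {M L : Type} [AddCommGroup M] [Module A M] [AddCommGroup L] [Module A L]
    {r : A} (hr : IsSMulRegular M r) [Subsingleton (Abelian.Ext (ModuleCat.of A L) (.of A M) 1)]
    (f : L →ₗ[A] QuotSMulTop r M) :
    ∃ g : L →ₗ[A] M, (r • (⊤ : Submodule A M)).mkQ ∘ₗ g = f := by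
  obtain ⟨y, hy⟩ := exists_of_extQuotSMulTop_eq_zero hr (Abelian.Ext.mk₀ (ModuleCat.ofHom f))
    (Subsingleton.elim _ _)
  obtain ⟨g, rfl⟩ := (Abelian.Ext.mk₀_bijective _ _).2 y
  rw [Abelian.Ext.mk₀_comp_mk₀] at hy
  have := (Abelian.Ext.mk₀_bijective _ _).1 hy
  exact ⟨g.hom, congr(($this).hom)⟩

variable [IsLocalRing A] [IsNoetherianRing A]

lemma subsingleton_ext_of_quotSMulTop {X K : Type} [AddCommGroup X] [Module A X] [Module.Finite A X]
    [AddCommGroup K] [Module A K] [Module.Finite A K] {r : A} (hrm : r ∈ maximalIdeal A)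
    (hr : IsSMulRegular X r) (n : ℕ)
    [Subsingleton (Abelian.Ext (ModuleCat.of A (QuotSMulTop r X)) (.of A K) (n + 1))] :
    Subsingleton (Abelian.Ext (ModuleCat.of A X) (.of A K) n) := by
  have h := IsSMulRegular.smulShortComplex_shortExact (M := .of A X) hr
  rw [← Submodule.subsingleton_iff A, ← subsingleton_iff_bot_eq_top, eq_comm]
  refine Submodule.eq_bot_of_le_smul_of_le_jacobson_bot (maximalIdeal A) _
    Module.Finite.fg_top (fun x _ ↦ ?_) (maximalIdeal_le_jacobson _)
  obtain ⟨y, rfl⟩ := Abelian.Ext.contravariant_sequence_exact₁ h (.of A K) x (add_comm 1 n)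
    (Subsingleton.elim (α := Abelian.Ext (ModuleCat.of A (QuotSMulTop r X)) (.of A K) (n + 1)) _ _)
  have (z : Abelian.Ext (ModuleCat.of A X) (.of A K) n) :
      (Abelian.Ext.mk₀ (r • 𝟙 (ModuleCat.of A X))).comp z (zero_add n) = r • z := by
    rw [Abelian.Ext.mk₀_smul, Abelian.Ext.smul_comp, Abelian.Ext.mk₀_id_comp]
  exact (this y).symm ▸ Submodule.smul_mem_smul hrm trivial

/-- Bass' lemma. -/
lemma subsingleton_ext_of_residueField {K : Type}
    [AddCommGroup K] [Module A K] [Module.Finite A K] (d : ℕ)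
    (hK : ∀ n, d ≤ n → Subsingleton (Abelian.Ext (ModuleCat.of A (ResidueField A)) (.of A K) n))
    (I : Ideal A) (X : Type) [AddCommGroup X] [Module A X] [Module.Finite A X]
    (hI : I ≤ Module.annihilator A X) (n : ℕ) (hn : d ≤ n) :
    Subsingleton (Abelian.Ext (ModuleCat.of A X) (.of A K) n) := by
  induction I using WellFoundedGT.induction generalizing X n with
  | ind I ih =>
  revert n
  induction ‹Module.Finite A X› using
    IsNoetherianRing.induction_on_isQuotientEquivQuotientPrime with
  | subsingleton N =>
    refine fun n _ ↦ subsingleton_of_forall_eq 0 fun x ↦ ?_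
    rw [← Abelian.Ext.mk₀_id_comp x,
      (isZero_of_subsingleton (ModuleCat.of A N)).eq_of_src (𝟙 _) 0, Abelian.Ext.mk₀_zero,
      Abelian.Ext.zero_comp]
  | quotient N p e =>
    intro n hn
    have hp : Module.annihilator A N = p.asIdeal := by
      rw [e.annihilator_eq, Ideal.annihilator_quotient]
    by_cases hm : p.asIdeal = maximalIdeal A
    · have e' : ModuleCat.of A N ≅ .of A (ResidueField A) :=
        (e ≪≫ₗ Submodule.quotEquivOfEq _ _ hm).toModuleIso
      have := hK n hn
      refine subsingleton_of_forall_eq 0 fun x ↦ ?_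
      rw [← Abelian.Ext.mk₀_id_comp x, ← e'.hom_inv_id, ← Abelian.Ext.mk₀_comp_mk₀_assoc,
        Subsingleton.elim ((Abelian.Ext.mk₀ e'.inv).comp x _) 0, Abelian.Ext.comp_zero]
    · obtain ⟨r, hrm, hrp⟩ := SetLike.exists_of_lt ((le_maximalIdeal p.2.ne_top).lt_of_ne hm)
      have hr : IsSMulRegular N r := by
        rw [e.isSMulRegular_congr]
        refine (isSMulRegular_quotient_iff_mem_of_smul_mem _ r).2 fun a ha ↦ ?_
        exact (p.2.mem_or_mem ha).resolve_left hrp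
      have : Subsingleton (Abelian.Ext (of A (QuotSMulTop r N)) (of A K) (n + 1)) := by
        refine ih (p.asIdeal ⊔ Ideal.span {r}) ?_ _ ?_ _ (by lia)
        · exact (hI.trans hp.le).trans_lt (by simpa using hrp)
        · refine sup_le (hp.ge.trans ?_) ((Ideal.span_singleton_le_iff_mem _).2 ?_)
          · exact LinearMap.annihilator_le_of_surjective _ (Submodule.mkQ_surjective _)
          · exact mem_annihilator_quotSMulTop r N
      exact subsingleton_ext_of_quotSMulTop hrm hr n
  | exact N₁ N₂ N₃ f g hf hg hfg h₁ h₃ =>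
    intro n hn
    have hS := ModuleCat.shortComplex_shortExact
      (ModuleCat.shortComplexOfCompEqZero f g hfg.linearMap_comp_eq_zero) hfg hf hg
    have := h₁ (hI.trans (f.annihilator_le_of_injective hf)) n hn
    have := h₃ (hI.trans (g.annihilator_le_of_surjective hg)) n hn
    refine subsingleton_of_forall_eq 0 fun x ↦ ?_
    obtain ⟨y, rfl⟩ := Abelian.Ext.contravariant_sequence_exact₂ hS (.of A K) x
      (Subsingleton.elim (α := Abelian.Ext (ModuleCat.of A N₁) (.of A K) n) _ _)
    rw [Subsingleton.elim (α := Abelian.Ext (ModuleCat.of A N₃) (.of A K) n) y 0]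
    exact Abelian.Ext.comp_zero _ _ _ _ _

end ModuleCat

section Matlis

variable {A : Type} [CommRing A] [IsLocalRing A]

/-- `E` behaves like the injective hull of the residue field with respect to finitely generated
modules annihilated by the ideal `J`. -/
structure IsMatlisModule (J : Ideal A) (E : Type) [AddCommGroup E] [Module A E] : Prop where
  exists_extension (L : Type) [AddCommGroup L] [Module A L] [Module.Finite A L]
    (hL : J ≤ Module.annihilator A L) (L' : Submodule A L) (g : L' →ₗ[A] E) :
    ∃ g' : L →ₗ[A] E, g' ∘ₗ L'.subtype = g
  nonempty_socle_equiv : Nonempty ((ResidueField A →ₗ[A] E) ≃ₗ[A] ResidueField A)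

namespace IsMatlisModule

variable {J : Ideal A} {E : Type} [AddCommGroup E] [Module A E]

lemma exists_apply_ne_zero (hE : IsMatlisModule J E) {L : Type} [AddCommGroup L] [Module A L]
    [Module.Finite A L] (hL : J ≤ Module.annihilator A L) {z : L} (hz : z ≠ 0) :
    ∃ f : L →ₗ[A] E, f z ≠ 0 := by
  obtain ⟨u⟩ := hE.nonempty_socle_equiv
  have hle : Ideal.torsionOf A L z ≤ maximalIdeal A :=
    le_maximalIdeal (by rwa [Ne, Ideal.torsionOf_eq_top_iff])
  let p : Submodule.span A {z} →ₗ[A] ResidueField A :=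
    Submodule.factor hle ∘ₗ (Ideal.quotTorsionOfEquivSpanSingleton A L z).symm.toLinearMap
  have hp : p ⟨z, Submodule.mem_span_singleton_self z⟩ = 1 := by
    have : Ideal.quotTorsionOfEquivSpanSingleton A L z (Submodule.Quotient.mk 1) =
        ⟨z, Submodule.mem_span_singleton_self z⟩ := by
      rw [Ideal.quotTorsionOfEquivSpanSingleton_apply_mk, one_smul]
    rw [← this]
    exact congrArg (Submodule.factor hle) (LinearEquiv.symm_apply_apply _ _)
  obtain ⟨g, hg⟩ := hE.exists_extension L hL _ (u.symm 1 ∘ₗ p)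
  refine ⟨g, fun h ↦ ?_⟩
  have h1 : u.symm 1 1 = 0 := by
    have h2 : g z = u.symm 1 (p ⟨z, Submodule.mem_span_singleton_self z⟩) :=
      congr($hg ⟨z, Submodule.mem_span_singleton_self z⟩)
    rw [← h, h2, hp]
  have h2 : u.symm 1 = 0 := by
    ext a
    obtain ⟨a, rfl⟩ := residue_surjective a
    have : residue A a = a • (1 : ResidueField A) := by
      rw [Algebra.smul_def, mul_one]; rfl
    rw [this, map_smul, h1, smul_zero, LinearMap.zero_apply]
  simp at h2

lemma exists_eval_residueField (hE : IsMatlisModule J E) (φ : (ResidueField A →ₗ[A] E) →ₗ[A] E) :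
    ∃ z, ∀ f, φ f = f z := by
  obtain ⟨u⟩ := hE.nonempty_socle_equiv
  have hsmul (a : A) : residue A a = a • (1 : ResidueField A) := by
    rw [Algebra.smul_def, mul_one]; rfl
  have hgen (f : ResidueField A →ₗ[A] E) : ∃ a : A, f = a • u.symm 1 := by
    obtain ⟨a, ha⟩ := residue_surjective (u f)
    refine ⟨a, ?_⟩
    rw [← map_smul, ← hsmul, ha, u.symm_apply_apply]
  have hker : maximalIdeal A ≤ LinearMap.ker (LinearMap.toSpanSingleton A E (φ (u.symm 1))) := by
    intro r hr
    rw [LinearMap.mem_ker, LinearMap.toSpanSingleton_apply, ← map_smul, ← map_smul, ← hsmul,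
      (residue_eq_zero_iff r).2 hr, map_zero, map_zero]
  obtain ⟨a, ha⟩ := hgen (Submodule.liftQ (maximalIdeal A) _ hker)
  have ha' : φ (u.symm 1) = a • u.symm 1 1 := by
    rw [← LinearMap.smul_apply, ← ha]
    exact (one_smul A _).symm
  refine ⟨residue A a, fun f ↦ ?_⟩
  obtain ⟨b, rfl⟩ := hgen f
  rw [map_smul, ha', hsmul, map_smul, LinearMap.smul_apply, smul_comm]

lemma exists_eval_of_isFiniteLength (hE : IsMatlisModule J E) {L : Type} [AddCommGroup L]
    [Module A L] (h : IsFiniteLength A L) (hL : J ≤ Module.annihilator A L)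
    (φ : (L →ₗ[A] E) →ₗ[A] E) : ∃ z, ∀ f, φ f = f z := by
  induction h with
  | of_subsingleton => exact ⟨0, fun f ↦ by rw [Subsingleton.elim f 0]; simp⟩
  | @of_simple_quotient L _ _ N _ hN ih =>
    have : IsNoetherian A L := (isFiniteLength_iff_isNoetherian_isArtinian.1
      (IsFiniteLength.of_simple_quotient hN)).1
    obtain ⟨e⟩ : Nonempty ((L ⧸ N) ≃ₗ[A] ResidueField A) := by
      obtain ⟨m, hm, he⟩ := isSimpleModule_iff_quot_maximal.1 ‹IsSimpleModule A (L ⧸ N)›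
      obtain rfl := eq_maximalIdeal hm
      exact he
    obtain ⟨a, ha⟩ := hE.exists_eval_residueField
      (φ ∘ₗ LinearMap.lcomp A E (e.toLinearMap ∘ₗ N.mkQ))
    obtain ⟨z, rfl⟩ := (e.surjective.comp N.mkQ_surjective) a
    have hz (f : L →ₗ[A] E) (hf : f ∘ₗ N.subtype = 0) : φ f = f z := by
      have hle : N ≤ LinearMap.ker f := fun n hn ↦ congr($hf ⟨n, hn⟩)
      have := ha (N.liftQ f hle ∘ₗ e.symm.toLinearMap)
      have h2 : (N.liftQ f hle ∘ₗ e.symm.toLinearMap) ∘ₗ (e.toLinearMap ∘ₗ N.mkQ) = f := by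
        ext; simp
      rw [LinearMap.comp_apply, LinearMap.lcomp_apply', h2] at this
      simpa using this
    let φ' : (L →ₗ[A] E) →ₗ[A] E := φ - LinearMap.applyₗ z
    have hφ' (f) : φ' f = φ f - f z := rfl
    let res : (L →ₗ[A] E) →ₗ[A] (N →ₗ[A] E) := LinearMap.lcomp A E N.subtype
    have hres : Function.Surjective res := hE.exists_extension L hL N
    have hker : LinearMap.ker res ≤ LinearMap.ker φ' := fun f hf ↦ by
      rw [LinearMap.mem_ker, hφ', hz f hf, sub_self]
    obtain ⟨n, hn⟩ := ih (hL.trans (LinearMap.annihilator_le_of_injective _ N.injective_subtype))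
      ((LinearMap.ker res).liftQ φ' hker ∘ₗ (res.quotKerEquivOfSurjective hres).symm.toLinearMap)
    refine ⟨z + n, fun f ↦ ?_⟩
    have := hn (res f)
    have h3 : (res.quotKerEquivOfSurjective hres).symm (res f) = Submodule.Quotient.mk f := by
      rw [LinearEquiv.symm_apply_eq]; rfl
    rw [LinearMap.comp_apply, LinearEquiv.coe_coe, h3] at this
    have : φ f - f z = f n := this
    rw [map_add, ← this]; abel

end IsMatlisModule
end Matlis

section RegularPair

variable {A : Type} [CommRing A]

lemma isSMulRegular_quotSMulTop_iff {M : Type} [AddCommGroup M] [Module A M] {x y : A} :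
    IsSMulRegular (QuotSMulTop x M) y ↔
      ∀ z : M, y • z ∈ x • (⊤ : Submodule A M) → z ∈ x • (⊤ : Submodule A M) :=
  isSMulRegular_quotient_iff_mem_of_smul_mem _ _

lemma exists_eq_smul_of_forall_mem {X K : Type} [AddCommGroup X] [Module A X] [AddCommGroup K]
    [Module A K] {x : A} (hx : IsSMulRegular K x) (f : X →ₗ[A] K)
    (hf : ∀ z, f z ∈ x • (⊤ : Submodule A K)) : ∃ h : X →ₗ[A] K, f = x • h := by
  have (z : X) : ∃ w : K, x • w = f z := by
    obtain ⟨w, -, hw⟩ := (Submodule.mem_smul_pointwise_iff_exists _ _ _).1 (hf z)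
    exact ⟨w, hw⟩
  choose h hh using this
  refine ⟨⟨⟨h, fun a b ↦ hx ?_⟩, fun r a ↦ hx ?_⟩, LinearMap.ext fun z ↦ (hh z).symm⟩
  · simp only [hh, smul_add, map_add]
  · simp only [hh, map_smul, RingHom.id_apply]
    rw [smul_comm, hh]

lemma isSMulRegular_linearMap {X K : Type} [AddCommGroup X] [Module A X] [AddCommGroup K]
    [Module A K] {x : A} (hx : IsSMulRegular K x) : IsSMulRegular (X →ₗ[A] K) x :=
  fun _ _ h ↦ LinearMap.ext fun z ↦ hx congr($h z)

lemma isSMulRegular_quotSMulTop_linearMap {X K : Type} [AddCommGroup X] [Module A X]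
    [AddCommGroup K] [Module A K] {x y : A} (hx : IsSMulRegular K x)
    (hy : IsSMulRegular (QuotSMulTop x K) y) : IsSMulRegular (QuotSMulTop x (X →ₗ[A] K)) y := by
  rw [isSMulRegular_quotSMulTop_iff] at hy ⊢
  intro f hf
  obtain ⟨g, -, hg⟩ := (Submodule.mem_smul_pointwise_iff_exists _ _ _).1 hf
  obtain ⟨h, rfl⟩ := exists_eq_smul_of_forall_mem hx f fun z ↦ hy _ (by
    rw [← LinearMap.smul_apply, ← hg]
    exact Submodule.smul_mem_pointwise_smul _ _ _ trivial)
  exact Submodule.smul_mem_pointwise_smul _ _ _ trivial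

lemma isArtinian_quotient_smul_top [IsNoetherianRing A] (hdim : ringKrullDim A ≤ 2) {x y : A}
    (hx : IsSMulRegular A x) (hy : IsSMulRegular (QuotSMulTop x A) y) (X : Type) [AddCommGroup X]
    [Module A X] [Module.Finite A X] :
    IsArtinian A (X ⧸ (Ideal.span {x, y} • (⊤ : Submodule A X))) := by
  have h1 : ringKrullDim (A ⧸ Ideal.span {x}) + 1 ≤ ringKrullDim A :=
    ringKrullDim_quotient_succ_le_of_nonZeroDivisor
      (mem_nonZeroDivisors_iff.2 ⟨fun z hz ↦ hx (by simpa using hz),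
        fun z hz ↦ hx (by simpa [mul_comm] using hz)⟩)
  have hy' : Ideal.Quotient.mk (Ideal.span {x}) y ∈ (A ⧸ Ideal.span {x})⁰ := by
    rw [mem_nonZeroDivisors_iff_right]
    intro z hz
    obtain ⟨z, rfl⟩ := Ideal.Quotient.mk_surjective z
    rw [← map_mul, Ideal.Quotient.eq_zero_iff_mem] at hz
    rw [Ideal.Quotient.eq_zero_iff_mem]
    have heq (a : A) : a ∈ Ideal.span {x} ↔ a ∈ x • (⊤ : Submodule A A) := by
      rw [Ideal.mem_span_singleton', Submodule.mem_smul_pointwise_iff_exists]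
      simp [mul_comm]
    rw [heq] at hz ⊢
    exact isSMulRegular_quotSMulTop_iff.1 hy z (by rwa [smul_eq_mul, mul_comm])
  have hle : Ideal.span {x} ≤ Ideal.span {x, y} := Ideal.span_mono (by simp)
  have h2 : ringKrullDim (A ⧸ Ideal.span {x, y}) + 1 ≤ ringKrullDim (A ⧸ Ideal.span {x}) :=
    ringKrullDim_succ_le_of_surjective (Ideal.Quotient.factor hle)
      (Ideal.Quotient.factor_surjective hle) hy' (by
        rw [Ideal.Quotient.factor_mk, Ideal.Quotient.eq_zero_iff_mem]
        exact Ideal.subset_span (by simp))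
  have : Ring.KrullDimLE 0 (A ⧸ Ideal.span {x, y}) := by
    rw [Ring.krullDimLE_iff]
    have h3 := (add_le_add_left h2 1).trans (h1.trans hdim)
    generalize ringKrullDim (A ⧸ Ideal.span {x, y}) = d at h3 ⊢
    induction d with
    | bot => simp
    | coe d =>
      induction d with
      | top => exact absurd h3 (by decide)
      | coe d =>
        replace h3 : ((d + 1 + 1 : ℕ) : WithBot ℕ∞) ≤ (2 : ℕ) := h3
        rw [Nat.cast_le] at h3
        norm_cast
        omega
  have := isArtinianRing_iff_krullDimLE_zero.2 this
  exact isArtinian_of_surjective_algebraMap (R := A ⧸ Ideal.span {x, y}) Ideal.Quotient.mk_surjective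

lemma annihilator_residueField [IsLocalRing A] :
    Module.annihilator A (ResidueField A) = maximalIdeal A :=
  Ideal.annihilator_quotient

variable [IsLocalRing A] [IsNoetherianRing A]

lemma exists_mem_pow_isSMulRegular (M : Type) [AddCommGroup M] [Module A M]
    [Module.Finite A M] [Subsingleton (ResidueField A →ₗ[A] M)] (n : ℕ) :
    ∃ x ∈ maximalIdeal A ^ n, IsSMulRegular M x := by
  obtain ⟨x, hx, hxM⟩ := (IsSMulRegular.subsingleton_linearMap_iff (R := A) (M := M)
    (N := ResidueField A)).1 inferInstance
  rw [annihilator_residueField] at hx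
  exact ⟨x ^ n, Ideal.pow_mem_pow hx n, hxM.pow n⟩

lemma exists_mem_pow_isSMulRegular₂ (M M' : Type) [AddCommGroup M] [Module A M]
    [Module.Finite A M] [AddCommGroup M'] [Module A M'] [Module.Finite A M']
    [Subsingleton (ResidueField A →ₗ[A] M)] [Subsingleton (ResidueField A →ₗ[A] M')] (n : ℕ) :
    ∃ x ∈ maximalIdeal A ^ n, IsSMulRegular M x ∧ IsSMulRegular M' x := by
  have : Subsingleton (ResidueField A →ₗ[A] M × M') :=
    (LinearMap.prodEquiv A).symm.toEquiv.subsingleton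
  obtain ⟨x, hx, h⟩ := exists_mem_pow_isSMulRegular (A := A) (M × M') n
  refine ⟨x, hx, fun a b hab ↦ ?_, fun a b hab ↦ ?_⟩
  · exact congrArg Prod.fst (@h (a, 0) (b, 0) (by simpa using hab))
  · exact congrArg Prod.snd (@h (0, a) (0, b) (by simpa using hab))

/-- Two modules of depth at least two have a common regular sequence of length two in any power
of the maximal ideal. -/
lemma exists_regular_pair (M M' : Type) [AddCommGroup M] [Module A M]
    [Module.Finite A M] [AddCommGroup M'] [Module A M'] [Module.Finite A M']
    (hM : ∀ i < 2, Subsingleton (Abelian.Ext (ModuleCat.of A (ResidueField A)) (.of A M) i))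
    (hM' : ∀ i < 2, Subsingleton (Abelian.Ext (ModuleCat.of A (ResidueField A)) (.of A M') i))
    (n : ℕ) :
    ∃ x ∈ maximalIdeal A ^ n, ∃ y ∈ maximalIdeal A ^ n,
      (IsSMulRegular M x ∧ IsSMulRegular (QuotSMulTop x M) y) ∧
        IsSMulRegular M' x ∧ IsSMulRegular (QuotSMulTop x M') y := by
  have := hM 0 (by simp)
  have := hM 1 (by simp)
  have := hM' 0 (by simp)
  have := hM' 1 (by simp)
  have := ModuleCat.subsingleton_ext_zero_iff.1 (hM 0 (by simp))
  have := ModuleCat.subsingleton_ext_zero_iff.1 (hM' 0 (by simp))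
  obtain ⟨x, hx, hxM, hxM'⟩ := exists_mem_pow_isSMulRegular₂ (A := A) M M' n
  have := ModuleCat.subsingleton_ext_zero_iff.1
    (ModuleCat.subsingleton_ext_quotSMulTop (L := ResidueField A) hxM 0)
  have := ModuleCat.subsingleton_ext_zero_iff.1
    (ModuleCat.subsingleton_ext_quotSMulTop (L := ResidueField A) hxM' 0)
  obtain ⟨y, hy, hyM, hyM'⟩ :=
    exists_mem_pow_isSMulRegular₂ (A := A) (QuotSMulTop x M) (QuotSMulTop x M') n
  exact ⟨x, hx, y, hy, ⟨hxM, hyM⟩, hxM', hyM'⟩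

end RegularPair

section Canonical

variable {A : Type} [CommRing A] {K : Type} [AddCommGroup K] [Module A K] {x y : A}

/-- The composition of the two connecting homomorphisms `Hom(L, K / (x, y)K) → Ext²(L, K)`
attached to a `K`-regular sequence `x, y`. -/
noncomputable def homToExtTwo (hx : IsSMulRegular K x) (hy : IsSMulRegular (QuotSMulTop x K) y)
    (L : Type) [AddCommGroup L] [Module A L] :
    (L →ₗ[A] QuotSMulTop y (QuotSMulTop x K)) →ₗ[A]
      Abelian.Ext (ModuleCat.of A L) (.of A K) 2 :=
  ModuleCat.extQuotSMulTop hx L 1 ∘ₗ ModuleCat.extQuotSMulTop hy L 0 ∘ₗ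
    (Abelian.Ext.linearEquiv₀ (R := A) (X := ModuleCat.of A L)
      (Y := .of A (QuotSMulTop y (QuotSMulTop x K))) ≪≫ₗ
        ModuleCat.homLinearEquiv (S := A)).symm.toLinearMap

lemma homToExtTwo_comp (hx : IsSMulRegular K x) (hy : IsSMulRegular (QuotSMulTop x K) y)
    {L L' : Type} [AddCommGroup L] [Module A L] [AddCommGroup L'] [Module A L']
    (f : L' →ₗ[A] L) (g : L →ₗ[A] QuotSMulTop y (QuotSMulTop x K)) :
    homToExtTwo hx hy L' (g ∘ₗ f) =
      (Abelian.Ext.mk₀ (ModuleCat.ofHom f)).comp (homToExtTwo hx hy L g) (zero_add 2) := by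
  have : Abelian.Ext.mk₀ (ModuleCat.ofHom (g ∘ₗ f)) =
      (Abelian.Ext.mk₀ (ModuleCat.ofHom f)).comp (.mk₀ (ModuleCat.ofHom g)) (zero_add 0) := by
    rw [Abelian.Ext.mk₀_comp_mk₀]; rfl
  change ModuleCat.extQuotSMulTop hx L' 1 (ModuleCat.extQuotSMulTop hy L' 0
    (Abelian.Ext.mk₀ (ModuleCat.ofHom (g ∘ₗ f)))) = _
  rw [this, ModuleCat.extQuotSMulTop_precomp, ModuleCat.extQuotSMulTop_precomp]
  rfl

lemma homToExtTwo_bijective (hx : IsSMulRegular K x) (hy : IsSMulRegular (QuotSMulTop x K) y)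
    {L : Type} [AddCommGroup L] [Module A L] (hxL : x ∈ Module.annihilator A L)
    (hyL : y ∈ Module.annihilator A L) : Function.Bijective (homToExtTwo hx hy L) := by
  have h0 : Subsingleton (Abelian.Ext (ModuleCat.of A L) (.of A (QuotSMulTop x K)) 0) :=
    ModuleCat.subsingleton_ext_zero_iff.2 (hy.linearMap_subsingleton_of_mem_annihilator hyL)
  have h1 : Subsingleton (Abelian.Ext (ModuleCat.of A L) (.of A K) 1) :=
    (ModuleCat.extQuotSMulTop_surjective hx hxL 0).subsingleton
  have b1 : Function.Bijective (ModuleCat.extQuotSMulTop hx L 1) :=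
    ⟨ModuleCat.extQuotSMulTop_injective hx 1, ModuleCat.extQuotSMulTop_surjective hx hxL 1⟩
  have b0 : Function.Bijective (ModuleCat.extQuotSMulTop hy L 0) :=
    ⟨ModuleCat.extQuotSMulTop_injective hy 0, ModuleCat.extQuotSMulTop_surjective hy hyL 0⟩
  exact b1.comp (b0.comp (LinearEquiv.bijective _))

lemma exists_comp_mkQ_comp_mkQ_eq (hx : IsSMulRegular K x)
    (hy : IsSMulRegular (QuotSMulTop x K) y) {X : Type} [AddCommGroup X] [Module A X]
    [Subsingleton (Abelian.Ext (ModuleCat.of A X) (.of A K) 1)]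
    [Subsingleton (Abelian.Ext (ModuleCat.of A X) (.of A K) 2)]
    (f : X →ₗ[A] QuotSMulTop y (QuotSMulTop x K)) :
    ∃ g : X →ₗ[A] K,
      (y • (⊤ : Submodule A (QuotSMulTop x K))).mkQ ∘ₗ (x • (⊤ : Submodule A K)).mkQ ∘ₗ g = f := by
  have := ModuleCat.subsingleton_ext_quotSMulTop (L := X) hx 1
  obtain ⟨g, rfl⟩ := ModuleCat.exists_comp_mkQ_eq hy f
  obtain ⟨g, rfl⟩ := ModuleCat.exists_comp_mkQ_eq hx g
  exact ⟨g, rfl⟩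

lemma mem_span_smul_top_of_mkQ_comp_mkQ_comp_eq_zero (hx : IsSMulRegular K x)
    (hy : IsSMulRegular (QuotSMulTop x K) y) {X : Type} [AddCommGroup X] [Module A X]
    [Subsingleton (Abelian.Ext (ModuleCat.of A X) (.of A K) 1)] (f : X →ₗ[A] K)
    (hf : (y • (⊤ : Submodule A (QuotSMulTop x K))).mkQ ∘ₗ
      (x • (⊤ : Submodule A K)).mkQ ∘ₗ f = 0) :
    f ∈ Ideal.span {x, y} • (⊤ : Submodule A (X →ₗ[A] K)) := by
  obtain ⟨g, hg⟩ := exists_eq_smul_of_forall_mem hy ((x • (⊤ : Submodule A K)).mkQ ∘ₗ f)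
    fun z ↦ (Submodule.Quotient.mk_eq_zero _).1 congr($hf z)
  obtain ⟨g, rfl⟩ := ModuleCat.exists_comp_mkQ_eq hx g
  obtain ⟨h, hh⟩ := exists_eq_smul_of_forall_mem hx (f - y • g) fun z ↦
    (Submodule.Quotient.eq _).1 congr($hg z)
  rw [← sub_add_cancel f (y • g), hh]
  exact add_mem (Submodule.smul_mem_smul (Ideal.subset_span (by simp)) trivial)
    (Submodule.smul_mem_smul (Ideal.subset_span (by simp)) trivial)

variable [IsLocalRing A] [IsNoetherianRing A] [Module.Finite A K]

lemma isMatlisModule_quotSMulTop_quotSMulTop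
    (hK3 : ∀ n, 3 ≤ n → Subsingleton (Abelian.Ext (ModuleCat.of A (ResidueField A)) (.of A K) n))
    (hK2 : Nonempty (Abelian.Ext (ModuleCat.of A (ResidueField A)) (.of A K) 2 ≃ₗ[A]
      ResidueField A))
    (hx : IsSMulRegular K x) (hy : IsSMulRegular (QuotSMulTop x K) y)
    (hxm : x ∈ maximalIdeal A) (hym : y ∈ maximalIdeal A) :
    IsMatlisModule (Ideal.span {x, y}) (QuotSMulTop y (QuotSMulTop x K)) where
  exists_extension L _ _ _ hL L' g := by
    have hbij (L : Type) [AddCommGroup L] [Module A L]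
        (hL : Ideal.span {x, y} ≤ Module.annihilator A L) :
        Function.Bijective (homToExtTwo hx hy L) :=
      homToExtTwo_bijective hx hy (hL (Ideal.subset_span (by simp)))
        (hL (Ideal.subset_span (by simp)))
    have hS := ModuleCat.shortComplex_shortExact
      (ModuleCat.shortComplexOfCompEqZero L'.subtype L'.mkQ
        (LinearMap.exact_subtype_mkQ L').linearMap_comp_eq_zero) (LinearMap.exact_subtype_mkQ L')
        L'.injective_subtype L'.mkQ_surjective
    have := ModuleCat.subsingleton_ext_of_residueField 3 hK3 ⊥ (L ⧸ L') bot_le 3 le_rfl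
    obtain ⟨z, hz⟩ := Abelian.Ext.contravariant_sequence_exact₁ hS (.of A K)
      (homToExtTwo hx hy L' g) (n₁ := 3) rfl
      (Subsingleton.elim (α := Abelian.Ext (ModuleCat.of A (L ⧸ L')) (.of A K) 3) _ _)
    obtain ⟨g', rfl⟩ := (hbij L hL).2 z
    refine ⟨g', (hbij L' (hL.trans
      (LinearMap.annihilator_le_of_injective _ L'.injective_subtype))).1 ?_⟩
    rw [homToExtTwo_comp]
    exact hz
  nonempty_socle_equiv := by
    obtain ⟨u⟩ := hK2
    exact ⟨LinearEquiv.ofBijective _ (homToExtTwo_bijective hx hy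
      (annihilator_residueField.ge hxm) (annihilator_residueField.ge hym)) ≪≫ₗ u⟩

lemma subsingleton_ext_of_regular_pair
    (hK3 : ∀ n, 3 ≤ n → Subsingleton (Abelian.Ext (ModuleCat.of A (ResidueField A)) (.of A K) n))
    {X : Type} [AddCommGroup X] [Module A X] [Module.Finite A X]
    (hx : IsSMulRegular X x) (hy : IsSMulRegular (QuotSMulTop x X) y)
    (hxm : x ∈ maximalIdeal A) (hym : y ∈ maximalIdeal A) (n : ℕ) (hn : 1 ≤ n) :
    Subsingleton (Abelian.Ext (ModuleCat.of A X) (.of A K) n) := by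
  have := ModuleCat.subsingleton_ext_of_residueField 3 hK3 ⊥
    (QuotSMulTop y (QuotSMulTop x X)) bot_le (n + 2) (by lia)
  have := ModuleCat.subsingleton_ext_of_quotSMulTop (K := K) hym hy (n + 1)
  exact ModuleCat.subsingleton_ext_of_quotSMulTop hxm hx n

end Canonical

section Biduality

variable {A : Type} [CommRing A]

lemma smul_top_le_ker {J : Ideal A} {X E : Type} [AddCommGroup X] [Module A X] [AddCommGroup E]
    [Module A E] (hE : J ≤ Module.annihilator A E) (f : X →ₗ[A] E) :
    J • (⊤ : Submodule A X) ≤ LinearMap.ker f :=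
  Submodule.smul_le.2 fun r hr z _ ↦ by
    rw [LinearMap.mem_ker, map_smul, Module.mem_annihilator.1 (hE hr)]

lemma le_annihilator_quotient_smul_top (J : Ideal A) (X : Type) [AddCommGroup X] [Module A X] :
    J ≤ Module.annihilator A (X ⧸ (J • (⊤ : Submodule A X))) := fun r hr ↦ by
  refine Module.mem_annihilator.2 fun z ↦ ?_
  obtain ⟨z, rfl⟩ := Submodule.mkQ_surjective _ z
  rw [← map_smul]
  exact (Submodule.Quotient.mk_eq_zero _).2 (Submodule.smul_mem_smul hr trivial)

lemma span_pair_le_annihilator (x y : A) (K : Type) [AddCommGroup K] [Module A K] :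
    Ideal.span {x, y} ≤ Module.annihilator A (QuotSMulTop y (QuotSMulTop x K)) := by
  rw [Ideal.span_le]
  rintro r (rfl | rfl)
  · exact LinearMap.annihilator_le_of_surjective _ (Submodule.mkQ_surjective _)
      (mem_annihilator_quotSMulTop r K)
  · exact mem_annihilator_quotSMulTop _ _

/-- The natural map from a module to its bidual with respect to `K`. -/
abbrev bidualEval (X K : Type) [AddCommGroup X] [Module A X] [AddCommGroup K] [Module A K] :
    X →ₗ[A] (X →ₗ[A] K) →ₗ[A] K :=
  (LinearMap.id : (X →ₗ[A] K) →ₗ[A] (X →ₗ[A] K)).flip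

lemma bijective_comp_bidualEval {K M N : Type} [AddCommGroup K] [Module A K]
    [AddCommGroup M] [Module A M] [AddCommGroup N]
    [Module A N] (hM : Function.Surjective (bidualEval (A := A) (M →ₗ[A] K) K))
    (hN : Function.Bijective (bidualEval (A := A) N K)) :
    Function.Bijective (fun φ : ((M →ₗ[A] K) →ₗ[A] K) →ₗ[A] N => φ.comp (bidualEval M K)) := by
  constructor
  · intro φ φ' h
    refine LinearMap.ext fun ξ ↦ hN.1 (LinearMap.ext fun g ↦ ?_)
    obtain ⟨u, hu⟩ := hM (g ∘ₗ φ)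
    obtain ⟨u', hu'⟩ := hM (g ∘ₗ φ')
    have huu : u = u' := LinearMap.ext fun m ↦ by
      have h1 : u m = g (φ (bidualEval M K m)) := congr($hu (bidualEval M K m))
      have h2 : u' m = g (φ' (bidualEval M K m)) := congr($hu' (bidualEval M K m))
      rw [h1, h2]
      exact congrArg g congr($h m)
    rw [← huu, hu] at hu'
    exact congr($hu' ξ)
  · intro ψ
    let e := LinearEquiv.ofBijective _ hN
    refine ⟨e.symm.toLinearMap ∘ₗ LinearMap.lcomp A K (LinearMap.lcomp A K ψ),
      LinearMap.ext fun m ↦ ?_⟩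
    change e.symm _ = _
    rw [LinearEquiv.symm_apply_eq]
    rfl

variable [IsLocalRing A] {K : Type} [AddCommGroup K] [Module A K] {x y : A}
  {X : Type} [AddCommGroup X] [Module A X]
  [Subsingleton (Abelian.Ext (ModuleCat.of A X) (.of A K) 1)]
  [Subsingleton (Abelian.Ext (ModuleCat.of A X) (.of A K) 2)]

lemma mem_span_smul_top_of_bidualEval_eq_zero [Module.Finite A X] (hx : IsSMulRegular K x)
    (hy : IsSMulRegular (QuotSMulTop x K) y)
    (hE : IsMatlisModule (Ideal.span {x, y}) (QuotSMulTop y (QuotSMulTop x K))) {z : X}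
    (hz : bidualEval (A := A) X K z = 0) : z ∈ Ideal.span {x, y} • (⊤ : Submodule A X) := by
  by_contra h
  obtain ⟨f, hf⟩ := hE.exists_apply_ne_zero
    (L := X ⧸ (Ideal.span {x, y} • (⊤ : Submodule A X))) (le_annihilator_quotient_smul_top _ X)
    (z := Submodule.Quotient.mk z) (by rwa [Ne, Submodule.Quotient.mk_eq_zero])
  obtain ⟨g, hg⟩ := exists_comp_mkQ_comp_mkQ_eq hx hy (f ∘ₗ Submodule.mkQ _)
  have hgz : g z = 0 := congr($hz g)
  have : _ = f (Submodule.Quotient.mk z) := congr($hg z)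
  rw [← this, LinearMap.comp_apply, LinearMap.comp_apply, hgz, map_zero, map_zero] at hf
  exact hf rfl

lemma exists_sub_bidualEval_mem_span_smul_top
    [Subsingleton (Abelian.Ext (ModuleCat.of A (X →ₗ[A] K)) (.of A K) 1)]
    (hx : IsSMulRegular K x) (hy : IsSMulRegular (QuotSMulTop x K) y)
    (hE : IsMatlisModule (Ideal.span {x, y}) (QuotSMulTop y (QuotSMulTop x K)))
    (hX : IsFiniteLength A (X ⧸ (Ideal.span {x, y} • (⊤ : Submodule A X))))
    (φ : (X →ₗ[A] K) →ₗ[A] K) :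
    ∃ z, φ - bidualEval X K z ∈
      Ideal.span {x, y} • (⊤ : Submodule A ((X →ₗ[A] K) →ₗ[A] K)) := by
  let q : K →ₗ[A] QuotSMulTop y (QuotSMulTop x K) := Submodule.mkQ _ ∘ₗ Submodule.mkQ _
  let Q : (X →ₗ[A] K) →ₗ[A] X →ₗ[A] QuotSMulTop y (QuotSMulTop x K) := LinearMap.compRight A q
  have hQ : Function.Surjective Q := exists_comp_mkQ_comp_mkQ_eq hx hy
  have hker : LinearMap.ker Q ≤ LinearMap.ker (q ∘ₗ φ) := fun f hf ↦
    smul_top_le_ker (span_pair_le_annihilator x y K) _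
      (mem_span_smul_top_of_mkQ_comp_mkQ_comp_eq_zero hx hy f hf)
  let ψ := (LinearMap.ker Q).liftQ (q ∘ₗ φ) hker ∘ₗ
    (Q.quotKerEquivOfSurjective hQ).symm.toLinearMap
  have hψ (g : X →ₗ[A] K) : ψ (Q g) = q (φ g) := by
    have : (Q.quotKerEquivOfSurjective hQ).symm (Q g) = Submodule.Quotient.mk g := by
      rw [LinearEquiv.symm_apply_eq]; rfl
    change (LinearMap.ker Q).liftQ (q ∘ₗ φ) hker _ = _
    rw [LinearEquiv.coe_coe, this]
    rfl
  obtain ⟨z, hz⟩ := hE.exists_eval_of_isFiniteLength hX (le_annihilator_quotient_smul_top _ X)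
    (ψ ∘ₗ LinearMap.lcomp A _ (Submodule.mkQ _))
  obtain ⟨z, rfl⟩ := Submodule.mkQ_surjective _ z
  refine ⟨z, mem_span_smul_top_of_mkQ_comp_mkQ_comp_eq_zero hx hy _ (LinearMap.ext fun g ↦ ?_)⟩
  have hg : ψ (Q g) = Q g z := hz (Submodule.liftQ _ (Q g)
    (smul_top_le_ker (span_pair_le_annihilator x y K) _))
  have : q (φ g) = q (g z) := (hψ g).symm.trans hg
  change q (φ g - g z) = 0
  rw [map_sub, this, sub_self]

end Biduality

section ExtGroup

variable {A : Type} [CommRing A]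

lemma subsingleton_ext_of_subsingleton_extGroup {L X : Type} [AddCommGroup L] [Module A L]
    [AddCommGroup X] [Module A X] {n : ℕ} (h : Subsingleton (extGroup A L X n)) :
    Subsingleton (Abelian.Ext (ModuleCat.of A L) (.of A X) n) := by
  let P := projectiveResolution (ModuleCat.of A L)
  obtain ⟨φ, hφ, -⟩ := P.exists_linearMap_homology_ext (.of A X) n
  have e := (P.isoExt (R := A) n (ModuleCat.of A X)).toLinearEquiv
  have : Subsingleton ((P.complex.linearYonedaObj A (.of A X)).homology n) :=
    (e.toEquiv.subsingleton_congr).1 h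
  exact hφ.subsingleton

lemma nonempty_extGroup_linearEquiv (L X : Type) [AddCommGroup L] [Module A L]
    [AddCommGroup X] [Module A X] {n : ℕ} (hn : n ≠ 0) :
    Nonempty (extGroup A L X n ≃ₗ[A] Abelian.Ext (ModuleCat.of A L) (.of A X) n) := by
  let P := projectiveResolution (ModuleCat.of A L)
  obtain ⟨φ, hφ, hφ'⟩ := P.exists_linearMap_homology_ext (.of A X) n
  exact ⟨(P.isoExt n (.of A X)).toLinearEquiv ≪≫ₗ LinearEquiv.ofBijective φ ⟨hφ' hn, hφ⟩⟩

lemma subsingleton_ext_of_lt_eDepth {L X : Type} [AddCommGroup L] [Module A L]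
    [AddCommGroup X] [Module A X] {n : ℕ} (h : n < eDepth A L X) :
    Subsingleton (Abelian.Ext (ModuleCat.of A L) (.of A X) n) := by
  refine subsingleton_ext_of_subsingleton_extGroup ?_
  by_contra hn
  rw [not_subsingleton_iff_nontrivial] at hn
  exact h.not_ge (sInf_le ⟨n, hn, rfl⟩)

end ExtGroup

section Main

/-- A canonical module of a two-dimensional local ring, expressed through the groups
`CategoryTheory.Abelian.Ext`. -/
structure IsDualizing (A : Type) [CommRing A] [IsLocalRing A] (K : Type) [AddCommGroup K]
    [Module A K] : Prop where
  finite : Module.Finite A K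
  subsingleton_ext (n : ℕ) (hn : n ≠ 2) :
    Subsingleton (Abelian.Ext (ModuleCat.of A (ResidueField A)) (.of A K) n)
  nonempty_equiv : Nonempty (Abelian.Ext (ModuleCat.of A (ResidueField A)) (.of A K) 2 ≃ₗ[A]
    ResidueField A)

variable {A : Type} [CommRing A] [IsLocalRing A] {K : Type} [AddCommGroup K] [Module A K]

lemma IsCanonicalModule.isDualizing (hK : IsCanonicalModule A 2 K) : IsDualizing A K where
  finite := hK.1
  subsingleton_ext n hn := subsingleton_ext_of_subsingleton_extGroup (hK.2.1 n hn)
  nonempty_equiv := by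
    obtain ⟨e⟩ := nonempty_extGroup_linearEquiv (A := A) (ResidueField A) K two_ne_zero
    obtain ⟨u⟩ := hK.2.2
    exact ⟨e.symm ≪≫ₗ u⟩

variable [IsNoetherianRing A]

lemma IsDualizing.subsingleton_ext_of_depth (hK : IsDualizing A K) {X : Type} [AddCommGroup X]
    [Module A X] [Module.Finite A X]
    (hX : ∀ i < 2, Subsingleton (Abelian.Ext (ModuleCat.of A (ResidueField A)) (.of A X) i))
    (n : ℕ) (hn : 1 ≤ n) : Subsingleton (Abelian.Ext (ModuleCat.of A X) (.of A K) n) := by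
  have := hK.finite
  obtain ⟨x, hx, y, hy, h, -⟩ := exists_regular_pair X X hX hX 1
  rw [pow_one] at hx hy
  exact subsingleton_ext_of_regular_pair (fun n hn ↦ hK.subsingleton_ext n (by lia)) h.1 h.2 hx hy
    n hn

lemma IsDualizing.subsingleton_ext_linearMap (hK : IsDualizing A K) (X : Type) [AddCommGroup X]
    [Module A X] [Module.Finite A X] (n : ℕ) (hn : 1 ≤ n) :
    Subsingleton (Abelian.Ext (ModuleCat.of A (X →ₗ[A] K)) (.of A K) n) := by
  have := hK.finite
  have hK1 := fun i (hi : i < 2) ↦ hK.subsingleton_ext i hi.ne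
  obtain ⟨x, hx, y, hy, h, -⟩ := exists_regular_pair K K hK1 hK1 1
  rw [pow_one] at hx hy
  exact subsingleton_ext_of_regular_pair (fun n hn ↦ hK.subsingleton_ext n (by lia))
    (isSMulRegular_linearMap h.1) (isSMulRegular_quotSMulTop_linearMap h.1 h.2) hx hy n hn

lemma IsDualizing.bidualEval_bijective (hK : IsDualizing A K) (hdim : ringKrullDim A ≤ 2)
    (hA : ∀ i < 2, Subsingleton (Abelian.Ext (ModuleCat.of A (ResidueField A)) (.of A A) i))
    (X : Type) [AddCommGroup X] [Module A X] [Module.Finite A X]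
    (hX : ∀ n, 1 ≤ n → Subsingleton (Abelian.Ext (ModuleCat.of A X) (.of A K) n)) :
    Function.Bijective (bidualEval (A := A) X K) := by
  have := hK.finite
  have hK3 := fun n (hn : 3 ≤ n) ↦ hK.subsingleton_ext n (by lia)
  have := hX 1 le_rfl
  have := hX 2 one_le_two
  have := hK.subsingleton_ext_linearMap X 1 le_rfl
  have key (n : ℕ) : ∃ x y : A, Ideal.span {x, y} ≤ maximalIdeal A ^ (n + 1) ∧
      IsSMulRegular K x ∧ IsSMulRegular (QuotSMulTop x K) y ∧
      IsMatlisModule (Ideal.span {x, y}) (QuotSMulTop y (QuotSMulTop x K)) ∧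
      IsArtinian A (X ⧸ (Ideal.span {x, y} • (⊤ : Submodule A X))) := by
    obtain ⟨x, hx, y, hy, h, h'⟩ := exists_regular_pair K A
      (fun i hi ↦ hK.subsingleton_ext i hi.ne) hA (n + 1)
    refine ⟨x, y, ?_, h.1, h.2, isMatlisModule_quotSMulTop_quotSMulTop hK3 hK.nonempty_equiv h.1 h.2
      (Ideal.pow_le_self n.succ_ne_zero hx) (Ideal.pow_le_self n.succ_ne_zero hy),
      isArtinian_quotient_smul_top hdim h'.1 h'.2 X⟩
    rw [Ideal.span_le]
    rintro r (rfl | rfl) <;> assumption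
  constructor
  · rw [injective_iff_map_eq_zero]
    intro z hz
    rw [← Submodule.mem_bot A, ← Ideal.iInf_pow_smul_eq_bot_of_isLocalRing (maximalIdeal A)
      (Ideal.IsPrime.ne_top inferInstance), Submodule.mem_iInf]
    intro n
    obtain ⟨x, y, hle, hx, hy, hE, -⟩ := key n
    exact Submodule.smul_mono_left (hle.trans (Ideal.pow_le_pow_right n.le_succ))
      (mem_span_smul_top_of_bidualEval_eq_zero hx hy hE hz)
  · obtain ⟨x, y, hle, hx, hy, hE, hX⟩ := key 0
    rw [← LinearMap.range_eq_top, ← top_le_iff]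
    refine Submodule.le_of_le_smul_of_le_jacobson_bot (I := Ideal.span {x, y})
      Module.Finite.fg_top
      (hle.trans ((Ideal.pow_le_self one_ne_zero).trans (maximalIdeal_le_jacobson _))) fun φ _ ↦ ?_
    obtain ⟨z, hz⟩ := exists_sub_bidualEval_mem_span_smul_top hx hy hE
      (isFiniteLength_iff_isNoetherian_isArtinian.2 ⟨inferInstance, hX⟩) φ
    rw [← add_sub_cancel (bidualEval X K z) φ]
    exact add_mem (Submodule.mem_sup_left ⟨z, rfl⟩) (Submodule.mem_sup_right hz)

end Main

/-- Macaulayfication is left adjoint to the inclusion of maximal Cohen-Macaulay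
modules: over a reduced Cohen-Macaulay local ring `(A, 𝔪)` of Krull dimension two
with canonical module `K`, for every finitely generated `M` and every maximal
Cohen-Macaulay `N`, precomposition with the canonical evaluation map
`M → M^† = Hom_A(Hom_A(M, K), K)` gives a bijection
`Hom_A(M^†, N) → Hom_A(M, N)`. -/
theorem stmt9 (A : Type) [CommRing A] [IsLocalRing A] [IsNoetherianRing A] [IsReduced A]
    (hdim : ringKrullDim A = 2)
    (hCM : eDepth A (ResidueField A) A = 2)
    (K : Type) [AddCommGroup K] [Module A K] (hK : IsCanonicalModule A 2 K)
    (M : Type) [AddCommGroup M] [Module A M] [Module.Finite A M]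
    (N : Type) [AddCommGroup N] [Module A N] (hN : IsMCMMod A N) :
    Function.Bijective (fun φ : ((M →ₗ[A] K) →ₗ[A] K) →ₗ[A] N =>
      φ.comp ((LinearMap.id : (M →ₗ[A] K) →ₗ[A] (M →ₗ[A] K)).flip)) := by
  have hK' := hK.isDualizing
  have := hK'.finite
  have := hN.1
  have hNdepth : eDepth A (ResidueField A) N = 2 := by
    exact WithBot.coe_injective (hN.2.trans hdim)
  have hA : ∀ i < 2, Subsingleton (Abelian.Ext (ModuleCat.of A (ResidueField A)) (.of A A) i) :=
    fun i hi ↦ subsingleton_ext_of_lt_eDepth (by rw [hCM]; exact_mod_cast hi)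
  refine bijective_comp_bidualEval
    (hK'.bidualEval_bijective hdim.le hA _ (hK'.subsingleton_ext_linearMap M)).2
    (hK'.bidualEval_bijective hdim.le hA N (hK'.subsingleton_ext_of_depth fun i hi ↦
      subsingleton_ext_of_lt_eDepth ?_))
  rw [hNdepth]
  exact_mod_cast hi
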